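/- arXiv:2412.12633 — 2 statements merged into one kernel-verified Lean document; each statement's English description precedes it below -/
import Mathlib

section
/- Let Γ = (V, E, s, t, wt) be a finite weighted directed multigraph with edge weights in a commutative ring R, let k ≥ 1, and let v ∈ V. For each voltage assignment ν : E → S_k, let Γ̃_ν denote the derived k-fold cover of Γ. Then k · Σ_{ν : E → S_k} A_{(v,1)}(Γ̃_ν) = (k!)^{|E|} · A_v(Γ) · Π_{w ∈ V} ( Σ_{e ∈ E, s(e) = w} wt(e) )^{k−1}. Equivalently, when the voltages ν(e) are chosen independently and uniformly at random and the weights lie in ℝ, the expected value of the arborescence ratio R(Γ̃_ν) = A_{(v,1)}(Γ̃_ν)/A_v(Γ) equals (1/k) · Π_{w ∈ V} ( Σ_{e ∈ E, s(e)=w} wt(e) )^{k−1}. -/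
open Classical in
/-- The weighted sum of spanning arborescences rooted at `v` of the directed multigraph
with edge set `E`, vertex set `V`, source map `s`, target map `t` and weights `wt`.
An arborescence rooted at `v` assigns to each vertex `w ≠ v` an edge `T w` with source `w`,
such that iterating the step map `w ↦ t (T w)` from any vertex eventually reaches `v`. -/
noncomputable def arbSum {V E R : Type} [Fintype V] [DecidableEq V] [Fintype E]
    [CommRing R] (s t : E → V) (wt : E → R) (v : V) : R :=
  ∑ T : {w : V // w ≠ v} → E,
    if (∀ w : {w : V // w ≠ v}, s (T w) = (w : V)) ∧
       (∀ w : V, ∃ n : ℕ,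
         (fun u => if h : u = v then v else t (T ⟨u, h⟩))^[n] w = v)
    then ∏ w : {w : V // w ≠ v}, wt (T w) else 0


theorem alt_avg {ι R M : Type*} [Fintype ι] [DecidableEq ι] [CommRing R] [IsDomain R] [CharZero R]
    [AddCommGroup M] [Module R M] (f : M [⋀^ι]→ₗ[R] R) (a b : ι → M) (bb : M)
    (hb : ∀ x, ∑ σ : Equiv.Perm ι, b (σ x) = (Fintype.card (Equiv.Perm ι) : R) • bb) :
    ∑ σ : Equiv.Perm ι, f (fun x => a x + b (σ x))
      = (Fintype.card (Equiv.Perm ι) : R) * f (fun x => a x + bb) := by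
  have h1 : ∀ c : ι → M, f (fun x => a x + c x) = ∑ s : Finset ι, f (s.piecewise a c) :=
    fun c => f.toMultilinearMap.map_add_univ a c
  simp_rw [fun σ : Equiv.Perm ι => h1 (fun x => b (σ x)), h1 (fun _ => bb)]
  rw [Finset.sum_comm, Finset.mul_sum]
  refine Finset.sum_congr rfl fun s _ => ?_
  by_cases h : ∃ x y, x ∉ s ∧ y ∉ s ∧ x ≠ y
  · obtain ⟨x, y, hx, hy, hxy⟩ := h
    have e2 : f (s.piecewise a (fun _ => bb)) = 0 :=
      f.map_eq_zero_of_eq _ (by simp [hx, hy]) hxy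
    rw [e2, mul_zero]
    have e1 := Equiv.sum_comp (Equiv.mulRight (Equiv.swap x y))
      (fun σ : Equiv.Perm ι => f (s.piecewise a (fun x => b (σ x))))
    have e3 : ∀ σ : Equiv.Perm ι, f (s.piecewise a (fun z => b ((Equiv.mulRight (Equiv.swap x y) σ) z)))
        = - f (s.piecewise a (fun x => b (σ x))) := by
      intro σ
      rw [← f.map_swap _ hxy]
      congr 1
      funext z
      by_cases hz : z ∈ s
      · have : Equiv.swap x y z = z :=
          Equiv.swap_apply_of_ne_of_ne (by rintro rfl; exact hx hz) (by rintro rfl; exact hy hz)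
        simp [hz, this]
      · have : Equiv.swap x y z ∉ s := by
          rw [Equiv.swap_apply_def]; split_ifs <;> assumption
        simp [hz, this]
    simp_rw [e3] at e1
    rw [Finset.sum_neg_distrib] at e1
    exact self_eq_neg.mp e1.symm
  · by_cases h0 : ∃ x, x ∉ s
    · obtain ⟨x, hx⟩ := h0
      have hs : ∀ c : ι → M, s.piecewise a c = Function.update a x (c x) := by
        intro c
        funext z
        by_cases hz : z = x
        · subst hz; simp [hx]
        · have : z ∈ s := by
            by_contra hzs
            exact h ⟨z, x, hzs, hx, hz⟩
          simp [hz, this]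
      simp_rw [hs]
      rw [← smul_eq_mul, ← f.map_update_smul, ← hb x, f.map_update_sum]
    · push Not at h0
      have hs : ∀ c : ι → M, s.piecewise a c = a := by
        intro c; funext z; simp [h0 z]
      simp [hs]

/-- The permutation matrix of `σ`. -/
def permMat {K : Type*} [DecidableEq K] (R : Type*) [CommRing R] (σ : Equiv.Perm K) : Matrix K K R :=
  Matrix.of fun i j => if σ i = j then 1 else 0

theorem det_avg {K n R : Type*} [Fintype K] [dK : DecidableEq K] [Fintype n] [DecidableEq n]
    [CommRing R] [IsDomain R] [CharZero R] (B : Matrix n n R) (U : Matrix n K R) (W : Matrix K n R)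
    (c : R) (hc : (Fintype.card K : R) * c = 1) :
    ∑ σ : Equiv.Perm K, (B + U * permMat R σ * W).det
      = (Fintype.card (Equiv.Perm K) : R) * (B + U * (Matrix.of fun _ _ => c : Matrix K K R) * W).det := by
  let low : n → K ⊕ n → R := fun i => Sum.elim (fun x => - U i x) (fun j => B i j)
  let f : (K ⊕ n → R) [⋀^K]→ₗ[R] R :=
    { toFun := fun r => Matrix.det (Matrix.of (Sum.elim r low))
      map_update_add' := by
        intro inst m i x y
        have hinst : dK = inst := Subsingleton.elim _ _
        subst hinst
        have : ∀ z, Matrix.det (Matrix.of (Sum.elim (Function.update m i z) low))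
          = Matrix.detRowAlternating (Function.update (Sum.elim m low) (Sum.inl i) z) := by
          intro z
          rw [Sum.update_elim_inl]
          rfl
        refine (this _).trans ?_
        rw [AlternatingMap.map_update_add]
        exact congrArg₂ _ (this _).symm (this _).symm
      map_update_smul' := by
        intro inst m i x y
        have hinst : dK = inst := Subsingleton.elim _ _
        subst hinst
        have : ∀ z, Matrix.det (Matrix.of (Sum.elim (Function.update m i z) low))
          = Matrix.detRowAlternating (Function.update (Sum.elim m low) (Sum.inl i) z) := by
          intro z
          rw [Sum.update_elim_inl]
          rfl
        refine (this _).trans ?_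
        rw [AlternatingMap.map_update_smul]
        exact congrArg _ (this _).symm
      map_eq_zero_of_eq' := by
        intro m i j hij hne
        exact Matrix.det_zero_of_row_eq (i := Sum.inl i) (j := Sum.inl j) (by simpa using hne)
          hij }
  have hf : ∀ P : Matrix K K R, (B + U * P * W).det
      = f (fun x => (Sum.elim (Pi.single x 1) 0 : K ⊕ n → R) + (Sum.elim 0 ((P * W) x) : K ⊕ n → R)) := by
    intro P
    have : (B + U * P * W) = B - (-U) * (P * W) := by
      rw [Matrix.neg_mul, sub_neg_eq_add, Matrix.mul_assoc]
    rw [this, ← Matrix.det_fromBlocks_one₁₁]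
    change _ = Matrix.det _
    congr 1
    ext i j
    rcases i with i | i <;> rcases j with j | j <;> simp [Matrix.one_apply, Pi.single_apply, eq_comm, low]
  have hP : ∀ (σ : Equiv.Perm K) x, (permMat R σ * W) x
      = W (σ x) := by
    intro σ x
    ext j
    simp [Matrix.mul_apply, permMat]
  simp_rw [hf, hP]
  have key : ∀ x y : K, ∑ σ : Equiv.Perm K, (if σ x = y then (1:R) else 0) = (Fintype.card (Equiv.Perm K) : R) * c := by
    intro x y
    have h1 : ∀ y', ∑ σ : Equiv.Perm K, (if σ x = y' then (1:R) else 0)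
        = ∑ σ : Equiv.Perm K, (if σ x = y then (1:R) else 0) := by
      intro y'
      rw [← Equiv.sum_comp (Equiv.mulLeft (Equiv.swap y y'))]
      refine Finset.sum_congr rfl fun σ _ => ?_
      congr 1
      simp only [Equiv.coe_mulLeft, Equiv.Perm.coe_mul, Function.comp]
      rw [Equiv.swap_apply_eq_iff]; simp
    have h2 : ∑ y', ∑ σ : Equiv.Perm K, (if σ x = y' then (1:R) else 0) = Fintype.card (Equiv.Perm K) := by
      rw [Finset.sum_comm]; simp
    simp_rw [h1] at h2
    rw [Finset.sum_const, nsmul_eq_mul, Finset.card_univ] at h2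
    rw [← h2]
    linear_combination (-(∑ σ : Equiv.Perm K, (if σ x = y then (1:R) else 0))) * hc
  convert alt_avg f (fun x => Sum.elim (Pi.single x 1) 0) (fun y => Sum.elim 0 (W y))
    (Sum.elim 0 (fun j => ∑ y, c * W y j)) ?_ using 3
  · ext x j
    rcases j with j | j <;> simp [Matrix.mul_apply]
  · intro x
    ext j
    rcases j with j | j
    · simp [Finset.sum_apply]
    · simp only [Finset.sum_apply, Sum.elim_inr, Pi.smul_apply, smul_eq_mul]
      have : ∀ σ : Equiv.Perm K, W (σ x) j = ∑ y, (if σ x = y then 1 else 0) * W y j := by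
        intro σ; simp
      simp_rw [this]
      rw [Finset.sum_comm]
      simp_rw [← Finset.sum_mul, key, Finset.mul_sum, mul_assoc]

theorem det_step {V R : Type*} [Fintype V] [DecidableEq V] [CommRing R] [IsDomain R] (v : V)
    (g : {w : V // w ≠ v} → V) [Decidable (∀ w : V, ∃ n : ℕ,
         (fun u => if h : u = v then v else g ⟨u, h⟩)^[n] w = v)] :
    (Matrix.of fun w u : {w : V // w ≠ v} => (if w = u then (1:R) else 0) - if g w = u then 1 else 0).det
     = if (∀ w : V, ∃ n : ℕ, (fun u => if h : u = v then v else g ⟨u, h⟩)^[n] w = v) then 1 else 0 := by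
  classical
  set st : V → V := fun u => if h : u = v then v else g ⟨u, h⟩ with hst
  have hg : ∀ w : {w : V // w ≠ v}, g w = st w := by
    intro w; simp [hst, w.2]
  split_ifs with h
  · let d : V → ℕ := fun w => Nat.find (h w)
    have hd : ∀ w : {w : V // w ≠ v}, d (g w) < d w := by
      intro w
      have h1 := Nat.find_spec (h w)
      have h0 : Nat.find (h w) ≠ 0 := by
        intro h0
        rw [h0] at h1
        exact w.2 h1
      obtain ⟨m, hm⟩ := Nat.exists_eq_succ_of_ne_zero h0
      have : d (g w) ≤ m := by
        apply Nat.find_min'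
        rw [hm, Function.iterate_succ_apply] at h1
        rw [hg]; exact h1
      change d (g w) < Nat.find (h w)
      omega
    have hbt : Matrix.BlockTriangular (Matrix.of fun w u : {w : V // w ≠ v} => (if w = u then (1:R) else 0) - if g w = u then 1 else 0)
        (fun w => OrderDual.toDual (d w)) := by
      intro i j hij
      have hij' : d i < d j := hij
      have h1 : i ≠ j := by rintro rfl; omega
      have h2 : g i ≠ j := by
        intro e
        have := hd i
        rw [e] at this; omega
      simp [h1, h2]
    rw [hbt.det]
    refine Finset.prod_eq_one fun a _ => ?_
    rw [show Matrix.toSquareBlock _ _ a = 1 from ?_, Matrix.det_one]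
    ext i j
    have h2 : g i ≠ j := by
      intro e
      have := hd i
      rw [e] at this
      have h3 : d i = d j := OrderDual.toDual.injective (i.2.trans j.2.symm)
      omega
    simp [Matrix.toSquareBlock_def, h2, Matrix.one_apply, Subtype.ext_iff]
  · rw [← Matrix.exists_mulVec_eq_zero_iff]
    let X : V → R := fun w => if ∃ n, st^[n] w = v then 0 else 1
    have hX : ∀ w, X (st w) = X w := by
      intro w
      have : (∃ n, st^[n] (st w) = v) ↔ ∃ n, st^[n] w = v := by
        constructor
        · rintro ⟨n, hn⟩
          exact ⟨n+1, by rwa [Function.iterate_succ_apply]⟩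
        · rintro ⟨n, hn⟩
          refine ⟨n, ?_⟩
          rw [← Function.iterate_succ_apply, Function.iterate_succ_apply', hn]
          simp [hst]
      simp only [X, this]
    have hXv : X v = 0 := by
      have : ∃ n, st^[n] v = v := ⟨0, rfl⟩
      simp only [X, if_pos this]
    refine ⟨fun w => X w, ?_, ?_⟩
    · push Not at h
      obtain ⟨w, hw⟩ := h
      have h1 : ¬ ∃ n, st^[n] w = v := by push Not; exact hw
      intro h0
      have := congrFun h0 ⟨w, hw 0⟩
      simp only [X, if_neg h1] at this
      exact one_ne_zero this
    · ext w
      simp only [Matrix.mulVec, dotProduct, Matrix.of_apply, sub_mul, Finset.sum_sub_distrib, ite_mul, one_mul, zero_mul]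
      rw [Finset.sum_ite_eq]
      simp only [Finset.mem_univ, if_true, Pi.zero_apply]
      rw [← hX w, ← hg, sub_eq_zero]
      by_cases hv : g w = v
      · rw [hv, hXv, Finset.sum_eq_zero]
        intro u _
        rw [if_neg (Ne.symm u.2)]
      · rw [Finset.sum_eq_single ⟨g w, hv⟩] <;> simp
        intro a ha h1 h2
        exact absurd h2.symm h1

theorem arbSum_map {V E R S : Type} [Fintype V] [DecidableEq V] [Fintype E]
    [CommRing R] [CommRing S] (φ : R →+* S) (s t : E → V) (wt : E → R) (v : V) :
    φ (arbSum s t wt v) = arbSum s t (fun e => φ (wt e)) v := by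
  classical
  unfold arbSum
  rw [map_sum]
  refine Finset.sum_congr rfl fun T _ => ?_
  rw [apply_ite φ, map_prod, map_zero]

theorem matrix_tree {V E R : Type} [Fintype V] [DecidableEq V] [Fintype E]
    [CommRing R] [IsDomain R] (s t : E → V) (wt : E → R) (v : V) :
    arbSum s t wt v = (Matrix.of fun w u : {w : V // w ≠ v} => ∑ e, (if s e = w then wt e else 0) *
      ((if w = u then 1 else 0) - if t e = u then 1 else 0)).det := by
  classical
  have h : (Matrix.of fun w u : {w : V // w ≠ v} => ∑ e, (if s e = w then wt e else 0) *
      ((if w = u then 1 else 0) - if t e = u then 1 else 0)).det =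
      (Matrix.detRowAlternating (R := R)).toMultilinearMap (fun w : {w : V // w ≠ v} => ∑ e, (if s e = w then wt e else 0) •
      (fun u : {w : V // w ≠ v} => ((if w = u then (1 : R) else 0) - if t e = u then 1 else 0))) := by
    change Matrix.det _ = Matrix.det _
    congr 1
    ext w u
    simp only [Matrix.of_apply]
    rw [Finset.sum_apply]
    rfl
  rw [h, MultilinearMap.map_sum]
  unfold arbSum
  refine Finset.sum_congr rfl fun T _ => ?_
  rw [MultilinearMap.map_smul_univ]
  have h2 := det_step (R := R) v (fun w => t (T w))
  change _ = _ * Matrix.det (Matrix.of fun w u : {w : V // w ≠ v} => (if w = u then (1:R) else 0) - if t (T w) = u then 1 else 0)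
  rw [h2]
  by_cases h1 : ∀ w : {w : V // w ≠ v}, s (T w) = (w : V)
  · simp only [h1, if_true, true_and, implies_true]
    split_ifs <;> simp
  · rw [if_neg (fun h => h1 h.1)]
    push Not at h1
    obtain ⟨w, hw⟩ := h1
    rw [Finset.prod_eq_zero (Finset.mem_univ w) (by rw [if_neg hw]), zero_mul]

/-- Generalised cover Laplacian with arbitrary matrices on the edges, root removed. -/
def covM {V E K R : Type} [DecidableEq V] [DecidableEq K] [Fintype E] [CommRing R]
    (s t : E → V) (wt : E → R) (r : V × K) (Q : E → Matrix K K R) :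
    Matrix {p : V × K // p ≠ r} {p : V × K // p ≠ r} R :=
  Matrix.of fun p q => (if p = q then ∑ e, (if s e = p.1.1 then wt e else 0) else 0) -
    ∑ e, (if s e = p.1.1 ∧ t e = q.1.1 then wt e else 0) * Q e p.1.2 q.1.2

theorem covM_update {V E K R : Type} [Fintype V] [DecidableEq V] [Fintype K] [DecidableEq K]
    [Fintype E] [DecidableEq E] [CommRing R] [IsDomain R] [CharZero R]
    (s t : E → V) (wt : E → R) (r : V × K) (Q : E → Matrix K K R) (e0 : E)
    (c : R) (hc : (Fintype.card K : R) * c = 1) :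
    ∑ σ : Equiv.Perm K, (covM s t wt r (Function.update Q e0 (permMat R σ))).det
      = (Fintype.card (Equiv.Perm K) : R) *
        (covM s t wt r (Function.update Q e0 (Matrix.of fun _ _ => c))).det := by
  have h : ∀ P : Matrix K K R, covM s t wt r (Function.update Q e0 P) =
      covM s t wt r (Function.update Q e0 0) +
      (Matrix.of fun (p : {p : V × K // p ≠ r}) (x : K) => if s e0 = p.1.1 ∧ p.1.2 = x then - wt e0 else 0) * P *
      (Matrix.of fun (x : K) (q : {p : V × K // p ≠ r}) => if t e0 = q.1.1 ∧ q.1.2 = x then (1 : R) else 0) := by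
    intro P
    ext p q
    have h1 : ∀ P : Matrix K K R, ∑ e, (if s e = p.1.1 ∧ t e = q.1.1 then wt e else 0) *
        (Function.update Q e0 P) e p.1.2 q.1.2 = (if s e0 = p.1.1 ∧ t e0 = q.1.1 then wt e0 else 0) * P p.1.2 q.1.2
        + ∑ e ∈ Finset.univ.erase e0, (if s e = p.1.1 ∧ t e = q.1.1 then wt e else 0) * Q e p.1.2 q.1.2 := by
      intro P
      rw [← Finset.add_sum_erase _ _ (Finset.mem_univ e0), Function.update_self]
      congr 1
      refine Finset.sum_congr rfl fun e he => ?_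
      rw [Function.update_of_ne (Finset.ne_of_mem_erase he)]
    simp only [covM, Matrix.of_apply, Matrix.add_apply, h1, Matrix.zero_apply, mul_zero, zero_add]
    have h2 : ((Matrix.of fun (p : {p : V × K // p ≠ r}) (x : K) => if s e0 = p.1.1 ∧ p.1.2 = x then - wt e0 else 0) * P *
      (Matrix.of fun (x : K) (q : {p : V × K // p ≠ r}) => if t e0 = q.1.1 ∧ q.1.2 = x then (1 : R) else 0)) p q
      = - ((if s e0 = p.1.1 ∧ t e0 = q.1.1 then wt e0 else 0) * P p.1.2 q.1.2) := by
      simp only [Matrix.mul_apply, Matrix.of_apply]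
      by_cases ha : s e0 = p.1.1 <;> by_cases hb : t e0 = q.1.1 <;> simp [ha, hb]
    rw [h2]
    ring
  rw [Finset.sum_congr rfl (fun σ _ => congrArg Matrix.det (h (permMat R σ))),
    h (Matrix.of fun _ _ => c)]
  exact det_avg _ _ _ c hc

theorem covM_sum {V E K R : Type} [Fintype V] [DecidableEq V] [Fintype K] [DecidableEq K]
    [Fintype E] [DecidableEq E] [CommRing R] [IsDomain R] [CharZero R]
    (s t : E → V) (wt : E → R) (r : V × K)
    (c : R) (hc : (Fintype.card K : R) * c = 1) (S : Finset E) :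
    ∑ ν : E → Equiv.Perm K, (covM s t wt r (fun e => permMat R (ν e))).det
      = ∑ ν : E → Equiv.Perm K, (covM s t wt r
        (fun e => if e ∈ S then (Matrix.of fun _ _ => c) else permMat R (ν e))).det := by
  induction S using Finset.induction_on with
  | empty => simp
  | insert e0 S he ih =>
    rw [ih]
    have hN : (Fintype.card (Equiv.Perm K) : R) ≠ 0 := Nat.cast_ne_zero.mpr Fintype.card_ne_zero
    apply mul_left_cancel₀ hN
    set G : (E → Equiv.Perm K) → R := fun ν => (covM s t wt r
        (fun e => if e ∈ S then (Matrix.of fun _ _ => c) else permMat R (ν e))).det with hG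
    have h1 : (Fintype.card (Equiv.Perm K) : R) * ∑ ν, G ν =
        ∑ σ : Equiv.Perm K, ∑ ν, G (ν * Pi.mulSingle (M := fun _ : E => Equiv.Perm K) e0 σ) := by
      have : ∀ σ : Equiv.Perm K, ∑ ν, G (ν * Pi.mulSingle (M := fun _ : E => Equiv.Perm K) e0 σ) = ∑ ν, G ν := fun σ =>
        Equiv.sum_comp (Equiv.mulRight (Pi.mulSingle (M := fun _ : E => Equiv.Perm K) e0 σ)) G
      simp_rw [this]
      simp
    rw [h1, Finset.sum_comm, Finset.mul_sum]
    refine Finset.sum_congr rfl fun ν _ => ?_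
    have h2 : ∀ σ : Equiv.Perm K, G (ν * Pi.mulSingle (M := fun _ : E => Equiv.Perm K) e0 σ) = (covM s t wt r (Function.update
        (fun e => if e ∈ S then (Matrix.of fun _ _ => c) else permMat R (ν e)) e0 (permMat R (ν e0 * σ)))).det := by
      intro σ
      simp only [hG]
      congr 2
      funext e
      by_cases h : e = e0
      · subst h; simp [he]
      · simp [h, Pi.mulSingle_eq_of_ne h]
    simp_rw [h2]
    refine (Equiv.sum_comp (Equiv.mulLeft (ν e0)) (fun σ => (covM s t wt r (Function.update
        (fun e => if e ∈ S then (Matrix.of fun _ _ => c) else permMat R (ν e)) e0 (permMat R σ))).det)).trans ?_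
    rw [covM_update _ _ _ _ _ _ c hc]
    congr 3
    funext e
    by_cases h : e = e0
    · subst h; simp
    · simp [h]

theorem cover_tree {V E K R : Type} [Fintype V] [DecidableEq V] [Fintype K] [DecidableEq K]
    [Fintype E] [DecidableEq E] [CommRing R] [IsDomain R]
    (s t : E → V) (wt : E → R) (r : V × K) (ν : E → Equiv.Perm K) :
    arbSum (fun p : E × K => (s p.1, p.2)) (fun p : E × K => (t p.1, (ν p.1) p.2))
          (fun p : E × K => wt p.1) r = (covM s t wt r (fun e => permMat R (ν e))).det := by
  rw [matrix_tree]
  congr 1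
  ext p q
  obtain ⟨⟨w, i⟩, hp⟩ := p
  obtain ⟨⟨u, j⟩, hq⟩ := q
  simp only [Matrix.of_apply, covM, permMat, Subtype.mk.injEq, Prod.mk.injEq]
  rw [Fintype.sum_prod_type]
  have h1 : ∀ e : E, ∑ x : K, (if s e = w ∧ x = i then wt e else 0) *
      ((if w = u ∧ i = j then 1 else 0) - if t e = u ∧ (ν e) x = j then 1 else 0)
      = (if w = u ∧ i = j then (if s e = w then wt e else 0) else 0)
        - (if s e = w ∧ t e = u then wt e else 0) * (if ν e i = j then 1 else 0) := by
    intro e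
    rw [Finset.sum_eq_single i]
    · simp only [and_true]
      rw [mul_sub]
      congr 1
      · rw [mul_ite, mul_one, mul_zero]
      · by_cases h1 : s e = w <;> by_cases h3 : t e = u <;> simp [h1, h3]
    · intro x _ hx; simp [hx]
    · simp
  simp_rw [h1]
  rw [Finset.sum_sub_distrib]
  congr 1
  split_ifs <;> simp

/-- Averaged cover Laplacian. -/
def mbar {V R : Type} [Fintype V] [DecidableEq V] [CommRing R] (k : ℕ) (A : Matrix V V R) (v : V) (c : R) :
    Matrix {p : V × Fin (k+1) // p ≠ (v, 0)} {p : V × Fin (k+1) // p ≠ (v, 0)} R :=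
  Matrix.of fun p q => (if p = q then ∑ u, A p.1.1 u else 0) - A p.1.1 q.1.1 * c

/-- Reduced Laplacian. -/
def redA {V R : Type} [Fintype V] [DecidableEq V] [CommRing R] (A : Matrix V V R) (v : V) :
    Matrix {w : V // w ≠ v} {w : V // w ≠ v} R :=
  Matrix.of fun p q => (if p = q then ∑ u, A p.1 u else 0) - A p.1 q.1

theorem step3a {V R : Type} [Fintype V] [DecidableEq V] [CommRing R] (k : ℕ) (A : Matrix V V R)
    (v : V) (c : R) (hc : ((k + 1 : ℕ) : R) * c = 1) :
    (∏ w, ∑ u, A w u) * ((∑ u, A v u) * (((k + 1 : ℕ) : R) * (mbar k A v c).det))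
    = (∏ w, ∑ u, A w u) * ((∑ u, A v u) * ((redA A v).det * ∏ w, (∑ u, A w u) ^ k)) := by
  set D : V → R := fun w => ∑ u, A w u with hD
  let N := {p : V × Fin (k+1) // p ≠ (v, 0)}
  let W : Matrix V N R := Matrix.of fun u p => if p.1.1 = u then c else 0
  let U : Matrix N V R := Matrix.of fun p u => A p.1.1 u
  let Dg : Matrix N N R := Matrix.diagonal fun p => D p.1.1
  let Dv : Matrix V V R := Matrix.diagonal D
  have h1 : mbar k A v c = Dg - U * W := by
    ext p q
    simp [mbar, Dg, U, W, Matrix.mul_apply, Matrix.diagonal_apply, hD]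
  have h2 : Matrix.fromBlocks Dv 0 0 1 * Matrix.fromBlocks 1 W U Dg
      = Matrix.fromBlocks 1 W 0 1 * Matrix.fromBlocks (Dv - W * U) 0 U Dg := by
    have : Dv * W = W * Dg := by
      ext u p
      simp only [Dv, W, Dg, Matrix.diagonal_mul, Matrix.mul_diagonal, Matrix.of_apply]
      split_ifs with h
      · rw [h, mul_comm]
      · simp
    simp [Matrix.fromBlocks_multiply, this]
  have h3 := congrArg Matrix.det h2
  rw [Matrix.det_mul, Matrix.det_mul, Matrix.det_fromBlocks_one₁₁, Matrix.det_fromBlocks_zero₁₂,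
    Matrix.det_fromBlocks_zero₁₂, Matrix.det_fromBlocks_one₁₁, ← h1, Matrix.det_one, mul_one, Matrix.zero_mul, sub_zero, Matrix.det_one, one_mul,
    Matrix.det_diagonal, Matrix.det_diagonal] at h3
  have h4 : D v * ∏ p : N, D p.1.1 = ∏ w, D w ^ (k + 1) := by
    have := Fintype.prod_eq_mul_prod_subtype_ne (fun p : V × Fin (k+1) => D p.1) (v, 0)
    rw [← this, Fintype.prod_prod_type]
    simp
  let L : Matrix V V R := Matrix.of fun w u => (if w = u then D w else 0) - A w u
  have h5 : Dv - W * U = L.updateRow v ((1 - c) • L v + (c * D v) • Pi.single v 1) := by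
    ext w u
    have hw : (W * U) w u = (∑ p : N, if p.1.1 = w then c else 0) * A w u := by
      rw [Matrix.mul_apply, Finset.sum_mul]
      refine Finset.sum_congr rfl fun p _ => ?_
      simp only [W, U, Matrix.of_apply]
      split_ifs with h
      · rw [h]
      · simp
    have hs := Fintype.sum_eq_add_sum_subtype_ne (fun p : V × Fin (k+1) => if p.1 = w then c else 0) (v, 0)
    rw [Fintype.sum_prod_type_right, Finset.sum_congr rfl (fun x _ => Finset.sum_ite_eq' Finset.univ w (fun _ => c))] at hs
    simp only [Finset.sum_const, Finset.card_univ, Fintype.card_fin, nsmul_eq_mul, mul_ite, mul_zero,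
      Finset.sum_ite_eq', Finset.mem_univ, if_true, hc] at hs
    rw [Matrix.sub_apply, hw, ← sub_eq_iff_eq_add'.mpr hs]
    by_cases h : w = v
    · subst h
      simp only [Matrix.updateRow_self, Dv, L, Matrix.diagonal_apply, if_true, Pi.add_apply, Pi.smul_apply, Matrix.of_apply, Pi.single_apply, smul_eq_mul]
      by_cases h' : w = u
      · subst h'; simp; ring
      · simp [h', Ne.symm h']
    · rw [Matrix.updateRow_ne h]
      simp [Dv, L, Matrix.diagonal_apply, Ne.symm h]
  have h6 : L.det = 0 := by
    have hL : L.mulVec 1 = 0 := by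
      ext w
      simp [L, Matrix.mulVec, dotProduct, Finset.sum_sub_distrib, hD]
    have h7 : (L.adjugate * L).mulVec 1 = 0 := by
      rw [← Matrix.mulVec_mulVec, hL, Matrix.mulVec_zero]
    rw [Matrix.adjugate_mul] at h7
    have := congrFun h7 v
    simpa [Matrix.smul_mulVec] using this
  have h8 : (L.updateRow v (Pi.single v 1)).det = (redA A v).det := by
    rw [Matrix.twoBlockTriangular_det _ (fun w => w ≠ v)]
    · have e1 : Matrix.toSquareBlockProp (L.updateRow v (Pi.single v 1)) (fun w => w ≠ v) = redA A v := by
        ext p q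
        simp [Matrix.toSquareBlockProp, redA, L, Matrix.updateRow_ne p.2, hD, Subtype.ext_iff]
      have e2 : Matrix.toSquareBlockProp (L.updateRow v (Pi.single v 1)) (fun w => ¬ w ≠ v) = 1 := by
        ext p q
        have hp : p.1 = v := not_not.mp p.2
        have hq : q.1 = v := not_not.mp q.2
        have : p = q := Subtype.ext (hp.trans hq.symm)
        subst this
        simp [Matrix.toSquareBlockProp, hp]
      rw [e1, e2, Matrix.det_one, mul_one]
    · intro i hi j hj
      have hi' : i = v := not_not.mp hi
      subst hi'
      simp [hj]
  have h9 : (Dv - W * U).det = c * D v * (redA A v).det := by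
    rw [h5, Matrix.det_updateRow_add, Matrix.det_updateRow_smul, Matrix.det_updateRow_smul, h8]
    have : L.updateRow v (L v) = L := Matrix.updateRow_eq_self L v
    rw [this, h6]; ring
  rw [h9] at h3
  have h10 : ∏ w, D w ^ (k + 1) = (∏ w, D w ^ k) * ∏ w, D w := by
    rw [← Finset.prod_mul_distrib]; simp_rw [pow_succ]
  calc _ = ((k + 1 : ℕ) : R) * D v * ((∏ w, D w) * (mbar k A v c).det) := by ring
    _ = ((k + 1 : ℕ) : R) * D v * (c * D v * (redA A v).det * ∏ p : N, D p.1.1) := by rw [h3]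
    _ = (((k + 1 : ℕ) : R) * c) * D v * (redA A v).det * (D v * ∏ p : N, D p.1.1) := by ring
    _ = _ := by rw [hc, h4, h10]; ring

theorem mbar_map {V R S : Type} [Fintype V] [DecidableEq V] [CommRing R] [CommRing S] (φ : R →+* S)
    (k : ℕ) (A : Matrix V V R) (v : V) (c : R) :
    φ (mbar k A v c).det = (mbar k (A.map φ) v (φ c)).det := by
  rw [RingHom.map_det]
  congr 1
  ext p q
  simp [mbar, apply_ite φ]

theorem redA_map {V R S : Type} [Fintype V] [DecidableEq V] [CommRing R] [CommRing S] (φ : R →+* S)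
    (A : Matrix V V R) (v : V) :
    φ (redA A v).det = (redA (A.map φ) v).det := by
  rw [RingHom.map_det]
  congr 1
  ext p q
  simp [redA, apply_ite φ]

open Polynomial in
theorem step3 {V R : Type} [Fintype V] [DecidableEq V] [CommRing R] [IsDomain R] (k : ℕ) (A : Matrix V V R)
    (v : V) (c : R) (hc : ((k + 1 : ℕ) : R) * c = 1) :
    ((k + 1 : ℕ) : R) * (mbar k A v c).det = (redA A v).det * ∏ w, (∑ u, A w u) ^ k := by
  let A' : Matrix V V R[X] := Matrix.of fun w u => C (A w u) + if w = u then X else 0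
  have hD : ∀ w, ∑ u, A' w u ≠ 0 := by
    intro w
    have : ∑ u, A' w u = X + C (∑ u, A w u) := by
      simp [A', Finset.sum_add_distrib, add_comm]
    rw [this]
    exact X_add_C_ne_zero _
  have h := step3a k A' v (C c) (by
    rw [← hc.symm.subst (motive := fun x => C x = (1 : R[X])) C_1]; simp)
  have h := mul_left_cancel₀ (hD v) (mul_left_cancel₀ (Finset.prod_ne_zero_iff.mpr fun w _ => hD w) h)
  have h2 := congrArg (evalRingHom (0 : R)) h
  have hA : A'.map (evalRingHom (0:R)) = A := by
    ext w u
    simp only [A', Matrix.map_apply, Matrix.of_apply]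
    split_ifs <;> simp
  rw [map_mul, map_mul, mbar_map, redA_map, hA, map_prod] at h2
  have h3 : ∀ w u, (evalRingHom (0:R)) (A' w u) = A w u := fun w u => congrFun (congrFun hA w) u
  simp only [map_pow, map_sum, h3, map_natCast] at h2
  simpa using h2

theorem main_dom {V E R : Type} [Fintype V] [DecidableEq V] [Fintype E] [DecidableEq E] [CommRing R]
    [IsDomain R] [CharZero R]
    (s t : E → V) (wt : E → R) (k : ℕ) (v : V) (c : R) (hc : ((k + 1 : ℕ) : R) * c = 1) :
    ((k + 1 : ℕ) : R) *
      ∑ ν : E → Equiv.Perm (Fin (k + 1)),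
        arbSum (fun p : E × Fin (k + 1) => (s p.1, p.2))
          (fun p : E × Fin (k + 1) => (t p.1, (ν p.1) p.2))
          (fun p : E × Fin (k + 1) => wt p.1) ((v, (0 : Fin (k + 1))))
    = ((Nat.factorial (k + 1)) ^ (Fintype.card E) : ℕ) * arbSum s t wt v *
      ∏ w : V, (∑ e ∈ Finset.univ.filter fun e => s e = w, wt e) ^ k := by
  simp_rw [cover_tree]
  rw [covM_sum s t wt (v, 0) c (by simpa using hc) Finset.univ]
  simp only [Finset.mem_univ, if_true, Finset.sum_const, Finset.card_univ, Fintype.card_pi,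
    Finset.prod_const, Fintype.card_perm, Fintype.card_fin, nsmul_eq_mul]
  let A : Matrix V V R := Matrix.of fun w u => ∑ e, if s e = w ∧ t e = u then wt e else 0
  have hA : ∀ w, ∑ u, A w u = ∑ e, if s e = w then wt e else 0 := by
    intro w
    simp only [A, Matrix.of_apply]
    rw [Finset.sum_comm]
    refine Finset.sum_congr rfl fun e _ => ?_
    by_cases h : s e = w <;> simp [h]
  have h1 : covM s t wt (v, (0 : Fin (k+1))) (fun _ => Matrix.of fun _ _ => c) = mbar k A v c := by
    ext p q
    simp only [covM, mbar, hA, Matrix.of_apply]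
    simp only [A, Matrix.of_apply, Finset.sum_mul]
  have h2 : arbSum s t wt v = (redA A v).det := by
    rw [matrix_tree]
    congr 1
    ext p q
    simp only [redA, Matrix.of_apply, hA, mul_sub, Finset.sum_sub_distrib]
    congr 1
    · split_ifs <;> simp
    · simp only [A, Matrix.of_apply]
      refine Finset.sum_congr rfl fun e _ => ?_
      by_cases h : s e = p <;> by_cases h' : t e = q <;> simp [h, h']
  have h3 := step3 k A v c hc
  simp_rw [Finset.sum_filter, ← hA]
  rw [h1, h2, mul_assoc, ← h3]
  ring

/-- For a weighted digraph `Γ` with voltage assignments `ν : E → S_{k+1}` chosen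
independently and uniformly at random, the expected arborescence ratio of the derived
(k+1)-fold cover satisfies
`(k+1) ⬝ Σ_ν A_{(v,1)}(Γ̃_ν) = ((k+1)!)^{|E|} ⬝ A_v(Γ) ⬝ Π_w (Σ_{s(e)=w} wt e)^k`.
Here the fold number `k+1` ranges over all integers ≥ 1, the element `1 ∈ {1,…,k+1}` is
encoded as `0 : Fin (k+1)`, and the derived cover has vertices `V × Fin (k+1)`, edges
`E × Fin (k+1)`, source `(e,x) ↦ (s e, x)`, target `(e,x) ↦ (t e, ν e x)`, weight `wt e`. -/
theorem expected_arborescence_ratio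
    {V E R : Type} [Fintype V] [DecidableEq V] [Fintype E] [DecidableEq E] [CommRing R]
    (s t : E → V) (wt : E → R) (k : ℕ) (v : V) :
    ((k + 1 : ℕ) : R) *
      ∑ ν : E → Equiv.Perm (Fin (k + 1)),
        arbSum (fun p : E × Fin (k + 1) => (s p.1, p.2))
          (fun p : E × Fin (k + 1) => (t p.1, (ν p.1) p.2))
          (fun p : E × Fin (k + 1) => wt p.1) ((v, (0 : Fin (k + 1))))
    = ((Nat.factorial (k + 1)) ^ (Fintype.card E) : ℕ) * arbSum s t wt v *
      ∏ w : V, (∑ e ∈ Finset.univ.filter fun e => s e = w, wt e) ^ k := by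
  have hZ : ∀ (wt : E → MvPolynomial E ℤ), ((k + 1 : ℕ) : MvPolynomial E ℤ) *
      ∑ ν : E → Equiv.Perm (Fin (k + 1)),
        arbSum (fun p : E × Fin (k + 1) => (s p.1, p.2))
          (fun p : E × Fin (k + 1) => (t p.1, (ν p.1) p.2))
          (fun p : E × Fin (k + 1) => wt p.1) ((v, (0 : Fin (k + 1))))
      = ((Nat.factorial (k + 1)) ^ (Fintype.card E) : ℕ) * arbSum s t wt v *
      ∏ w : V, (∑ e ∈ Finset.univ.filter fun e => s e = w, wt e) ^ k := by
    intro wt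
    apply MvPolynomial.map_injective (Int.castRingHom ℚ) Int.cast_injective
    have hc : ((k + 1 : ℕ) : MvPolynomial E ℚ) * MvPolynomial.C (1 / ((k + 1 : ℕ) : ℚ)) = 1 := by
      rw [← map_natCast (MvPolynomial.C (σ := E) (R := ℚ)), ← map_mul, mul_one_div_cancel, map_one]
      exact_mod_cast Nat.succ_ne_zero k
    have h := main_dom s t (fun e => MvPolynomial.map (Int.castRingHom ℚ) (wt e)) k v _ hc
    simpa only [map_mul, map_sum, map_prod, map_pow, map_natCast, arbSum_map] using h
  have h := congrArg (MvPolynomial.eval₂Hom (Int.castRingHom R) wt) (hZ MvPolynomial.X)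
  simpa only [map_mul, map_sum, map_prod, map_pow, map_natCast, arbSum_map,
    MvPolynomial.eval₂Hom_X'] using h
end

section
/- Fix integers k ≥ 2 and 1 ≤ t ≤ k−1. Let i_1, …, i_t be pairwise distinct elements of {2,…,k}, let j_1, …, j_t be pairwise distinct elements of {2,…,k}, and for a permutation σ ∈ S_k set Y_{σ,i,j} = 1{σ(i)=j} − 1{σ(i)=1}. Then Σ_{σ ∈ S_k} Π_{l=1}^{t} Y_{σ, i_l, j_l} = (1−t) · (k−t)!. In particular, this value depends only on t (and k), and it equals 0 when t = 1. -/
/-- The number of permutations with `t` prescribed values. -/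
lemma card_perm_prescribed (k t : ℕ) (i j : Fin t → Fin k) (hi : Function.Injective i)
    (hj : Function.Injective j) :
    (Finset.univ.filter (fun σ : Equiv.Perm (Fin k) => ∀ l, σ (i l) = j l)).card
      = Nat.factorial (k - t) := by
  classical
  let e : {x // x ∈ Set.range i} ≃ {x // x ∈ Set.range j} :=
    (Equiv.ofInjective i hi).symm.trans (Equiv.ofInjective j hj)
  let τ : Equiv.Perm (Fin k) := e.extendSubtype
  have hτ : ∀ l, τ (i l) = j l := by
    intro l
    have h := e.extendSubtype_apply_of_mem (i l) ⟨l, rfl⟩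
    have h2 : (Equiv.ofInjective i hi).symm ⟨i l, ⟨l, rfl⟩⟩ = l :=
      Equiv.ofInjective_symm_apply hi l
    change e.extendSubtype (i l) = j l
    rw [h]
    simp only [e, Equiv.trans_apply, h2]
    rfl
  have h1 : (Finset.univ.filter (fun σ : Equiv.Perm (Fin k) => ∀ l, σ (i l) = j l)).card
      = Fintype.card {f : Equiv.Perm (Fin k) // ∀ a, ¬ (a ∉ Set.range i) → f a = a} := by
    rw [Fintype.card_subtype]
    refine Finset.card_bij' (fun σ _ => τ⁻¹ * σ) (fun σ _ => τ * σ) ?_ ?_ ?_ ?_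
    · intro σ hσ
      simp only [Finset.mem_filter, Finset.mem_univ, true_and] at hσ ⊢
      intro a ha
      obtain ⟨l, rfl⟩ := not_not.mp ha
      rw [Equiv.Perm.mul_apply, hσ, ← hτ]
      exact τ.symm_apply_apply (i l)
    · intro σ hσ
      simp only [Finset.mem_filter, Finset.mem_univ, true_and] at hσ ⊢
      intro l
      rw [Equiv.Perm.mul_apply, hσ _ (not_not.mpr ⟨l, rfl⟩), hτ]
    · intro σ _
      simp
    · intro σ _
      simp
  rw [h1, ← Fintype.card_congr (Equiv.Perm.subtypeEquivSubtypePerm (fun a => a ∉ Set.range i)),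
    Fintype.card_perm, Fintype.card_subtype_compl]
  congr 1
  rw [Fintype.card_fin]
  congr 1
  rw [← Fintype.card_congr (Equiv.ofInjective i hi), Fintype.card_fin]

/-- Pointwise expansion of the product. -/
lemma prod_Y_expand (k t : ℕ) (z : Fin k) (i j : Fin t → Fin k) (hi : Function.Injective i)
    (hj0 : ∀ l, j l ≠ z) (σ : Equiv.Perm (Fin k)) :
    ∏ l : Fin t, ((if σ (i l) = j l then (1 : ℤ) else 0) - (if σ (i l) = z then 1 else 0))
    = (if ∀ l, σ (i l) = j l then (1 : ℤ) else 0)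
      - ∑ m : Fin t, (if ∀ l, σ (i l) = Function.update j m z l then (1 : ℤ) else 0) := by
  classical
  by_cases h : ∃ m, σ (i m) = z
  · obtain ⟨m, hm⟩ := h
    have hne : ∀ l, l ≠ m → σ (i l) ≠ z := by
      intro l hl h
      exact hl (hi (σ.injective (h.trans hm.symm)))
    have h1 : ¬ ∀ l, σ (i l) = j l := fun h => hj0 m ((h m).symm.trans hm)
    rw [if_neg h1, Finset.sum_eq_single m]
    · rw [← Finset.mul_prod_erase _ _ (Finset.mem_univ m)]
      have h2 : ∏ l ∈ Finset.univ.erase m,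
          ((if σ (i l) = j l then (1 : ℤ) else 0) - (if σ (i l) = z then 1 else 0))
          = ∏ l ∈ Finset.univ.erase m, (if σ (i l) = j l then (1 : ℤ) else 0) := by
        refine Finset.prod_congr rfl fun l hl => ?_
        rw [if_neg (hne l (Finset.ne_of_mem_erase hl)), sub_zero]
      rw [h2, Finset.prod_boole, hm, if_neg (hj0 m).symm, if_pos rfl]
      have h3 : (∀ l ∈ Finset.univ.erase m, σ (i l) = j l) ↔
          ∀ l, σ (i l) = Function.update j m z l := by
        constructor
        · intro h l
          by_cases hl : l = m
          · subst hl; simpa using hm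
          · rw [Function.update_of_ne hl]; exact h l (by simpa using hl)
        · intro h l hl
          rw [h l, Function.update_of_ne (Finset.ne_of_mem_erase hl)]
      simp only [h3]
      ring
    · intro m' _ hm'
      refine if_neg fun h => hne m' hm' ?_
      rw [h m', Function.update_self]
    · simp
  · push Not at h
    have h2 : ∀ m ∈ (Finset.univ : Finset (Fin t)),
        (if ∀ l, σ (i l) = Function.update j m z l then (1 : ℤ) else 0) = 0 := by
      intro m _
      refine if_neg fun h' => h m ?_
      rw [h' m, Function.update_self]
    rw [Finset.sum_eq_zero h2, sub_zero]
    simp only [h, if_false, sub_zero, Finset.prod_boole, Finset.mem_univ, true_imp_iff]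

/-- Fix `k ≥ 2` and `1 ≤ t ≤ k - 1`.  For pairwise distinct `i₁,…,i_t` and pairwise
distinct `j₁,…,j_t` in `{2,…,k}` (encoded as the nonzero elements of `Fin k`, with the
element `1` encoded as `0 : Fin k`), setting `Y_{σ,i,j} = 1{σ i = j} - 1{σ i = 1}`,
we have `Σ_{σ ∈ S_k} Π_{l=1}^{t} Y_{σ, i_l, j_l} = (1 - t) ⬝ (k - t)!`.
In particular this depends only on `t` (and `k`), and vanishes when `t = 1`. -/
theorem perm_Y_sum (k t : ℕ) (hk : 2 ≤ k) (ht : 1 ≤ t) (ht' : t ≤ k - 1)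
    (i j : Fin t → Fin k) (hi : Function.Injective i) (hj : Function.Injective j)
    (hi0 : ∀ l, i l ≠ ⟨0, by omega⟩) (hj0 : ∀ l, j l ≠ ⟨0, by omega⟩) :
    ∑ σ : Equiv.Perm (Fin k), ∏ l : Fin t,
      ((if σ (i l) = j l then (1 : ℤ) else 0) - (if σ (i l) = ⟨0, by omega⟩ then 1 else 0))
    = (1 - (t : ℤ)) * (Nat.factorial (k - t) : ℤ) := by
  simp only [prod_Y_expand k t ⟨0, by omega⟩ i j hi hj0]
  rw [Finset.sum_sub_distrib, Finset.sum_comm]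
  have hu : ∀ m, Function.Injective (Function.update j m ⟨0, by omega⟩) := by
    intro m a b hab
    by_cases ha : a = m <;> by_cases hb : b = m
    · rw [ha, hb]
    · subst ha
      rw [Function.update_self, Function.update_of_ne hb] at hab
      exact absurd hab.symm (hj0 b)
    · subst hb
      rw [Function.update_self, Function.update_of_ne ha] at hab
      exact absurd hab (hj0 a)
    · rw [Function.update_of_ne ha, Function.update_of_ne hb] at hab
      exact hj hab
  simp only [Finset.sum_boole, card_perm_prescribed k t i j hi hj,
    fun m => card_perm_prescribed k t i _ hi (hu m), Finset.sum_const, Finset.card_univ,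
    Fintype.card_fin, nsmul_eq_mul]
  ring
end
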